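/- Let n ≥ 0, W = EαⁿxF and W₂ = Eαⁿx₂F. Then: (1) every reduced computation C of S_α starting at W or at W₂ is semiproper, of length at most O(|W| + |V|) and area at most O((|W| + |V|)²), where V = τC; (2) each of CS_α(W, xF) and CS_α(W₂, x₂) consists of the single trivial computation; (3) CS_α(W, x₂) consists of exactly one computation, whose history is (α1)ⁿ(α2)(α3)ⁿ(α4), whose last word is W₂, and some word of this computation contains the subword Ex₁. -/

import Mathlib

/-! ### S-machines -/

/-- A group word over tape letters `T` and state letters `S`. -/
abbrev GWord (T S : Type) := List ((T ⊕ S) × Bool)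

/-- An `S`-rule `[U₁ → V₁, …, U_m → V_m]`, listed in left-to-right order. -/
structure SRule (T S : Type) where
  subs : List (GWord T S × GWord T S)
deriving DecidableEq

/-- The formal inverse of a group word. -/
def invWord {T S : Type} (w : GWord T S) : GWord T S := (w.map fun p => (p.1, !p.2)).reverse

/-- The inverse of an `S`-rule: if `τ = [Uᵢ → xᵢ Vᵢ' yᵢ]` where `Vᵢ'` starts and ends with
state letters, then `τ⁻¹ = [Vᵢ' → xᵢ⁻¹ Uᵢ yᵢ⁻¹]`. -/
def ruleInv {T S : Type} (r : SRule T S) : SRule T S :=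
  ⟨r.subs.map fun UV =>
    let x := UV.2.takeWhile fun p => p.1.isLeft
    let y := (UV.2.reverse.takeWhile fun p => p.1.isLeft).reverse
    ((UV.2.drop x.length).take (UV.2.length - x.length - y.length),
      invWord x ++ UV.1 ++ invWord y)⟩

/-- The hardware of an `S`-machine: `n` sectors of tape letters and `n + 1` components
of state letters. -/
structure SHardware (T S : Type) where
  n : ℕ
  Y : Fin n → Set T
  Q : Fin (n + 1) → Set S

/-- Lifting a word over tape letters to a group word. -/
def liftT {T S : Type} (u : List (T × Bool)) : GWord T S := u.map fun p => (Sum.inl p.1, p.2)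

/-- A word is freely reduced (irreducible): no adjacent pair `x x⁻¹` or `x⁻¹ x`. -/
def FreeReduced {β : Type} (u : List (β × Bool)) : Prop :=
  u.Chain' fun p q => ¬(p.1 = q.1 ∧ q.2 = !p.2)

/-- The admissible word `q₀ u₀ q₁ u₁ ⋯ u_{n-1} q_n`. -/
def SHardware.assemble {T S : Type} (H : SHardware T S) (q : Fin (H.n + 1) → S)
    (u : Fin H.n → List (T × Bool)) : GWord T S :=
  (((List.finRange H.n).map fun i => ((Sum.inr (q i.castSucc), true) :: liftT (u i))).flatten)
    ++ [(Sum.inr (q (Fin.last H.n)), true)]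

/-- A word is admissible for the hardware `H` if it lies in
`Q₁ F(Y₁) Q₂ F(Y₂) ⋯ F(Y_n) Q_{n+1}`. -/
def SHardware.Admissible {T S : Type} (H : SHardware T S) (w : GWord T S) : Prop :=
  ∃ (q : Fin (H.n + 1) → S) (u : Fin H.n → List (T × Bool)),
    (∀ i, q i ∈ H.Q i) ∧ (∀ i, (∀ p ∈ u i, p.1 ∈ H.Y i) ∧ FreeReduced (u i)) ∧
    w = H.assemble q u

/-- `Splice subs w z`: `w = x₀ U₁ x₁ U₂ ⋯ U_m x_m` and `z = x₀ V₁ x₁ V₂ ⋯ V_m x_m`,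
where `subs = [(U₁,V₁),…,(U_m,V_m)]` (simultaneous replacement, in order). -/
def Splice {T S : Type} : List (GWord T S × GWord T S) → GWord T S → GWord T S → Prop
  | [], w, z => w = z
  | UV :: rest, w, z =>
      ∃ x w₁ z₁, w = x ++ UV.1 ++ w₁ ∧ z = x ++ UV.2 ++ z₁ ∧ Splice rest w₁ z₁

/-- Applying an `S`-rule: replace the `Uᵢ` simultaneously by the `Vᵢ` and freely reduce. -/
def ApplyRule {T S : Type} (r : SRule T S) (w w' : GWord T S) : Prop :=
  ∃ z, Splice r.subs w z ∧ FreeGroup.Red z w' ∧ FreeReduced w'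

/-- An `S`-machine: a hardware together with a (finite, symmetric) list of rules. -/
structure SMachine (T S : Type) where
  H : SHardware T S
  rules : List (SRule T S)
  symm : ∀ r ∈ rules, ruleInv r ∈ rules

/-- `ws` is a computation of the `S`-machine `M` with history `h`: a nonempty sequence of
admissible words, each obtained from the previous one by applying the corresponding rule
of the history. -/
def IsComputation {T S : Type} (M : SMachine T S) (ws : List (GWord T S))
    (h : List (SRule T S)) : Prop :=
  ws ≠ [] ∧ h.length + 1 = ws.length ∧ (∀ w ∈ ws, M.H.Admissible w) ∧
  ∀ i, i < h.length →
    h.getD i ⟨[]⟩ ∈ M.rules ∧ ApplyRule (h.getD i ⟨[]⟩) (ws.getD i []) (ws.getD (i + 1) [])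

/-- A history is reduced: two mutually inverse rules are never applied next to
each other. -/
def ReducedHist {T S : Type} (h : List (SRule T S)) : Prop :=
  ∀ i, i + 1 < h.length → h.getD (i + 1) ⟨[]⟩ ≠ ruleInv (h.getD i ⟨[]⟩)

/-- The first word of a computation. -/
def firstW {T S : Type} (ws : List (GWord T S)) : GWord T S := ws.headI

/-- The last word `τC` of a computation. -/
def lastW {T S : Type} (ws : List (GWord T S)) : GWord T S := ws.getLastD []

/-- The computation `(ws, h)` connects `W` and `W'`. -/
def Connects {T S : Type} (M : SMachine T S) (ws : List (GWord T S)) (h : List (SRule T S))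
    (W W' : GWord T S) : Prop :=
  IsComputation M ws h ∧ firstW ws = W ∧ lastW ws = W'

/-- The number of occurrences of the negative letter `a⁻¹` in a word. -/
def negCount {T S : Type} [DecidableEq T] (a : T) (w : GWord T S) : ℕ :=
  w.countP fun p => (match p.1 with | Sum.inl t => decide (t = a) | Sum.inr _ => false) && !p.2

/-- A computation is semiproper: negative letters inserted during the computation
(in excess of those present in the first word) never disappear at a later stage. -/
def Semiproper {T S : Type} [DecidableEq T] (ws : List (GWord T S)) : Prop :=
  ∀ a : T, ∀ i j : ℕ, i ≤ j → j < ws.length →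
    negCount a (ws.getD i []) - negCount a (ws.getD 0 []) ≤ negCount a (ws.getD j [])

/-- A word is positive: it contains no negative letters. -/
def PositiveW {T S : Type} (w : GWord T S) : Prop := ∀ p ∈ w, p.2 = true

/-- Membership in `CS(W, v₁, …, v_k)`: `(ws, h)` is a reduced computation starting at `W`
whose last word contains each of the words in `vs` as a subword. -/
def InCS {T S : Type} (M : SMachine T S) (ws : List (GWord T S)) (h : List (SRule T S))
    (W : GWord T S) (vs : List (GWord T S)) : Prop :=
  IsComputation M ws h ∧ ReducedHist h ∧ firstW ws = W ∧ ∀ v ∈ vs, v <:+: lastW ws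

/-- The area of a computation: the sum of the lengths of its words. -/
def SArea {T S : Type} (ws : List (GWord T S)) : ℕ := (ws.map List.length).sum

/-! ### The `S`-machine `S_α` -/

/-- The state letters of `S_α`. -/
inductive St : Type
  | E | F | x | x1 | x2
deriving DecidableEq

open St

/-- A (positive) state letter, as a letter of a group word. -/
def st (y : St) : (Unit ⊕ St) × Bool := (Sum.inr y, true)

/-- The tape letter `α` or its inverse. -/
def al (b : Bool) : (Unit ⊕ St) × Bool := (Sum.inl (), b)

/-- The word `α^k`. -/
def apow (k : ℕ) : GWord Unit St := List.replicate k (al true)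

/-- The hardware of `S_α`: admissible words have the form `E α^k x α^n F`. -/
def HA : SHardware Unit St where
  n := 2
  Y := fun _ => Set.univ
  Q := ![{E}, {x, x1, x2}, {F}]

/-- Rule (α1): `x → α⁻¹ x α`. -/
def ruleA1 : SRule Unit St := ⟨[([st x], [al false, st x, al true])]⟩

/-- Rule (α2): `Ex → Ex₁`. -/
def ruleA2 : SRule Unit St := ⟨[([st E, st x], [st E, st x1])]⟩

/-- Rule (α3): `x₁ → α x₁ α⁻¹`. -/
def ruleA3 : SRule Unit St := ⟨[([st x1], [al true, st x1, al false])]⟩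

/-- Rule (α4): `x₁F → x₂F`. -/
def ruleA4 : SRule Unit St := ⟨[([st x1, st F], [st x2, st F])]⟩

/-- The `S`-machine `S_α`. -/
def MA : SMachine Unit St where
  H := HA
  rules := [ruleA1, ruleA2, ruleA3, ruleA4,
    ruleInv ruleA1, ruleInv ruleA2, ruleInv ruleA3, ruleInv ruleA4]
  symm := by decide

/-- `W = E αⁿ x F`. -/
def Wst (n : ℕ) : GWord Unit St := [st E] ++ apow n ++ [st x, st F]

/-- `W₂ = E αⁿ x₂ F`. -/
def W2 (n : ℕ) : GWord Unit St := [st E] ++ apow n ++ [st x2, st F]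

/-- The word `α^k` for an integer `k`. -/
def zword (k : ℤ) : GWord Unit St := List.replicate k.natAbs (al (decide (0 ≤ k)))

/-- The word `E α^k q α^m F`. -/
def tapeWord (q : St) (k m : ℤ) : GWord Unit St :=
  st E :: (zword k ++ st q :: (zword m ++ [st F]))

/-- The tape letter `α` as an element of the free group. -/
def alphaGen : FreeGroup (Unit ⊕ St) := FreeGroup.of (Sum.inl ())

lemma freeReduced_iff_isReduced {β : Type} (u : List (β × Bool)) :
    FreeReduced u ↔ FreeGroup.IsReduced u := by
  unfold FreeReduced FreeGroup.IsReduced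
  have : (fun p q : β × Bool => ¬(p.1 = q.1 ∧ q.2 = !p.2)) =
      fun a b => a.1 = b.1 → a.2 = b.2 := by
    funext p q
    rcases p with ⟨p, _ | _⟩ <;> rcases q with ⟨q, _ | _⟩ <;> simp
  rw [this]
  exact Iff.rfl

lemma red_iff_of_freeReduced {β : Type} {z w : List (β × Bool)} (hw : FreeReduced w) :
    FreeGroup.Red z w ↔ FreeGroup.mk z = FreeGroup.mk w := by
  classical
  rw [FreeGroup.Red.exact]
  constructor
  · exact fun h => ⟨w, h, .refl⟩
  · rintro ⟨v, hz, hv⟩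
    rwa [((freeReduced_iff_isReduced w).1 hw).red_iff_eq.1 hv] at hz

lemma eq_of_mk_eq {β : Type} {w w' : List (β × Bool)} (hw : FreeReduced w)
    (hw' : FreeReduced w') (h : FreeGroup.mk w = FreeGroup.mk w') : w = w' :=
  (((freeReduced_iff_isReduced w).1 hw).red_iff_eq.1
    ((red_iff_of_freeReduced hw').2 h)).symm

lemma mem_zword {k : ℤ} {p : (Unit ⊕ St) × Bool} (hp : p ∈ zword k) : p.1 = Sum.inl () := by
  rw [zword, List.mem_replicate] at hp
  rw [hp.2, al]

lemma st_notMem_zword (q : St) (k : ℤ) : st q ∉ zword k := fun h => by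
  simpa [st] using mem_zword h

lemma zword_eq_nil {k : ℤ} : zword k = [] ↔ k = 0 := by
  simp [zword]

lemma mk_zword (k : ℤ) : FreeGroup.mk (zword k) = alphaGen ^ k := by
  have hpow (b : Bool) (j : ℕ) : FreeGroup.mk (List.replicate j (al b)) =
      FreeGroup.mk [al b] ^ j := by
    induction j with
    | zero => rfl
    | succ j ih => rw [pow_succ', ← ih, FreeGroup.mul_mk]; rfl
  rcases le_total 0 k with h | h
  · lift k to ℕ using h
    simp [zword, alphaGen, FreeGroup.of, al]
  · obtain ⟨j, rfl⟩ := Int.exists_eq_neg_ofNat h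
    rcases j.eq_zero_or_pos with rfl | hj
    · simp [zword, FreeGroup.one_eq_mk]
    · have : FreeGroup.mk [al false] = alphaGen⁻¹ := by
        simp [alphaGen, FreeGroup.of, al, FreeGroup.invRev]
      simp [zword, hpow, this, hj.ne']

lemma freeReduced_replicate {β : Type} (j : ℕ) (p : β × Bool) :
    FreeReduced (List.replicate j p) := by
  rw [freeReduced_iff_isReduced]
  exact List.isChain_replicate_of_rel _ fun _ => rfl

lemma freeReduced_tapeWord (q : St) (k m : ℤ) :
    FreeReduced (tapeWord q k m) := by
  have hz (k : ℤ) : FreeGroup.IsReduced (zword k) :=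
    (freeReduced_iff_isReduced _).1 (freeReduced_replicate _ _)
  rw [freeReduced_iff_isReduced]
  unfold FreeGroup.IsReduced at hz ⊢
  have h1 (k : ℤ) {p} (hp : p ∈ (zword k).head?) : p.1 = Sum.inl () :=
    mem_zword (List.mem_of_mem_head? hp)
  have h2 (k : ℤ) {p} (hp : p ∈ (zword k).getLast?) : p.1 = Sum.inl () :=
    mem_zword (List.mem_of_mem_getLast? hp)
  rw [tapeWord, List.isChain_cons, List.isChain_append, List.isChain_cons, List.isChain_append]
  refine ⟨?_, hz k, ⟨?_, hz m, List.isChain_singleton _, ?_⟩, ?_⟩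
  · intro y hy
    rw [List.head?_append, Option.mem_def, Option.or_eq_some_iff] at hy
    rcases hy with hy | hy
    · simp [st, h1 k hy]
    · have : y = st q := by simpa using hy.2.symm
      simp [this, st]
  · intro y hy
    rw [List.head?_append, Option.mem_def, Option.or_eq_some_iff] at hy
    rcases hy with hy | hy
    · simp [st, h1 m hy]
    · have : y = st F := by simpa using hy.2.symm
      simp [this, st]
  · intro y hy
    simp [st, h2 m hy]
  · intro y hy
    simp [st, h2 k hy]

lemma mk_tapeWord (q : St) (k m : ℤ) : FreeGroup.mk (tapeWord q k m) =
    FreeGroup.mk [st E] * alphaGen ^ k * FreeGroup.mk [st q] * alphaGen ^ m *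
      FreeGroup.mk [st F] := by
  simp only [← mk_zword, FreeGroup.mul_mk, tapeWord]
  simp

lemma tapeWord_split {q s : St} {k m : ℤ} (hE : s ≠ E) (hF : s ≠ F)
    {a b : GWord Unit St} (h : tapeWord q k m = a ++ st s :: b) :
    q = s ∧ a = st E :: zword k ∧ b = zword m ++ [st F] := by
  rw [tapeWord, ← List.cons_append, List.append_cons_inj_of_notMem] at h
  · obtain ⟨rfl, h, rfl⟩ := h
    exact ⟨by simpa [st] using h, rfl, rfl⟩
  · simpa [st_notMem_zword] using by simpa [st] using hE
  · simpa [st_notMem_zword] using by simpa [st] using hF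

lemma applyRule_single {U V w w' : GWord Unit St} : ApplyRule ⟨[(U, V)]⟩ w w' ↔
    FreeReduced w' ∧ ∃ a b, w = a ++ U ++ b ∧
      FreeGroup.mk (a ++ V ++ b) = FreeGroup.mk w' := by
  constructor
  · rintro ⟨z, ⟨a, b, b', hw, rfl, rfl⟩, hred, hw'⟩
    exact ⟨hw', a, b, hw, (red_iff_of_freeReduced hw').1 hred⟩
  · rintro ⟨hw', a, b, hw, h⟩
    exact ⟨_, ⟨a, b, b, hw, rfl, rfl⟩, (red_iff_of_freeReduced hw').2 h, hw'⟩

lemma applyRule_shift {q s : St} (hE : s ≠ E) (hF : s ≠ F) (d : ℤ) {k m : ℤ}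
    {w' : GWord Unit St} :
    ApplyRule ⟨[([st s], zword d ++ [st s] ++ zword (-d))]⟩ (tapeWord q k m) w' ↔
      q = s ∧ w' = tapeWord s (k + d) (m - d) := by
  have key : FreeGroup.mk (st E :: zword k ++ (zword d ++ [st s] ++ zword (-d)) ++
      (zword m ++ [st F])) = FreeGroup.mk (tapeWord s (k + d) (m - d)) := by
    rw [mk_tapeWord, zpow_add, sub_eq_neg_add, zpow_add]
    simp only [← mk_zword, FreeGroup.mul_mk]
    simp
  rw [applyRule_single]
  constructor
  · rintro ⟨hw', a, b, h, hmk⟩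
    obtain ⟨rfl, rfl, rfl⟩ := tapeWord_split hE hF (a := a) (b := b) (by simpa using h)
    exact ⟨rfl, eq_of_mk_eq hw' (freeReduced_tapeWord _ _ _) (hmk.symm.trans key)⟩
  · rintro ⟨rfl, rfl⟩
    exact ⟨freeReduced_tapeWord _ _ _, _, _, by simp [tapeWord], key⟩

lemma applyRule_left {q s t : St} (hE : s ≠ E) (hF : s ≠ F) {k m : ℤ} {w' : GWord Unit St} :
    ApplyRule ⟨[([st E, st s], [st E, st t])]⟩ (tapeWord q k m) w' ↔
      q = s ∧ k = 0 ∧ w' = tapeWord t 0 m := by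
  have key : [] ++ [st E, st t] ++ (zword m ++ [st F]) = tapeWord t 0 m := by
    simp [tapeWord, zword_eq_nil.2 rfl]
  rw [applyRule_single]
  constructor
  · rintro ⟨hw', a, b, h, hmk⟩
    obtain ⟨rfl, h1, rfl⟩ := tapeWord_split hE hF (a := a ++ [st E]) (b := b) (by simpa using h)
    have hak : a = [] ∧ zword k = [] := by
      rcases (zword k).eq_nil_or_concat with hk | ⟨l, p, hk⟩
      · rw [hk] at h1
        simpa [hk] using h1
      · rw [hk, List.concat_eq_append, ← List.cons_append] at h1
        have := (List.append_inj' h1 rfl).2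
        have hp : p = st E := by simpa using this.symm
        exact absurd (by rw [hk, hp]; simp) (st_notMem_zword E k)
    obtain ⟨rfl, hk⟩ := hak
    rw [key] at hmk
    exact ⟨rfl, zword_eq_nil.1 hk,
      eq_of_mk_eq hw' (freeReduced_tapeWord _ _ _) hmk.symm⟩
  · rintro ⟨rfl, rfl, rfl⟩
    exact ⟨freeReduced_tapeWord _ _ _, [], zword m ++ [st F],
      by simp [tapeWord, zword_eq_nil.2 rfl], by rw [key]⟩

lemma applyRule_right {q s t : St} (hE : s ≠ E) (hF : s ≠ F) {k m : ℤ} {w' : GWord Unit St} :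
    ApplyRule ⟨[([st s, st F], [st t, st F])]⟩ (tapeWord q k m) w' ↔
      q = s ∧ m = 0 ∧ w' = tapeWord t k 0 := by
  have key : st E :: zword k ++ [st t, st F] ++ [] = tapeWord t k 0 := by
    simp [tapeWord, zword_eq_nil.2 rfl]
  rw [applyRule_single]
  constructor
  · rintro ⟨hw', a, b, h, hmk⟩
    obtain ⟨rfl, rfl, h1⟩ := tapeWord_split hE hF (a := a) (b := st F :: b) (by simpa using h)
    have hmb : zword m = [] ∧ b = [] := by
      rcases hz : zword m with _ | ⟨p, l⟩
      · simpa [hz] using h1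
      · rw [hz, List.cons_append, List.cons.injEq] at h1
        exact absurd (by rw [hz, h1.1]; simp) (st_notMem_zword F m)
    obtain ⟨hm, rfl⟩ := hmb
    rw [key] at hmk
    exact ⟨rfl, zword_eq_nil.1 hm,
      eq_of_mk_eq hw' (freeReduced_tapeWord _ _ _) hmk.symm⟩
  · rintro ⟨rfl, rfl, rfl⟩
    exact ⟨freeReduced_tapeWord _ _ _, st E :: zword k, [],
      by simp [tapeWord, zword_eq_nil.2 rfl], by rw [key]⟩

/-- The configurations reachable from `W` or `W₂`: the state letter of the middle component
together with the exponent `k` of `α` to the left of it (`k = n` for the letter `x₂`). -/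
inductive Config : Type
  | onX (k : ℤ)
  | onX1 (k : ℤ)
  | onX2

namespace Config

/-- The admissible word of a configuration; the exponents of `α` add up to `n`. -/
def word (n : ℕ) : Config → GWord Unit St
  | onX k => tapeWord x k (n - k)
  | onX1 k => tapeWord x1 k (n - k)
  | onX2 => tapeWord x2 n 0

/-- The number of negative letters in the word of a configuration. -/
def neg (n : ℕ) : Config → ℕ
  | onX k => (-k).toNat + (k - n).toNat
  | onX1 k => (-k).toNat + (k - n).toNat
  | onX2 => 0

/-- `Edge n r c d`: the rule `r` among (α1)–(α4) takes the configuration `c` to `d`. -/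
inductive Edge (n : ℕ) : SRule Unit St → Config → Config → Prop
  | a1 (k : ℤ) : Edge n ruleA1 (onX k) (onX (k - 1))
  | a2 : Edge n ruleA2 (onX 0) (onX1 0)
  | a3 (k : ℤ) : Edge n ruleA3 (onX1 k) (onX1 (k + 1))
  | a4 : Edge n ruleA4 (onX1 n) onX2

/-- `Step n r c d`: the rule `r` of `S_α` takes the configuration `c` to `d`. -/
def Step (n : ℕ) (r : SRule Unit St) (c d : Config) : Prop :=
  Edge n r c d ∨ ∃ s, Edge n s d c ∧ r = ruleInv s

end Config

open Config

lemma Config.Edge.ruleInv_ruleInv {n : ℕ} {r : SRule Unit St} {c d : Config}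
    (h : Edge n r c d) : ruleInv (ruleInv r) = r := by
  cases h <;> decide

lemma apply_word_iff {n : ℕ} {c : Config} {r : SRule Unit St} {w : GWord Unit St} :
    (r ∈ MA.rules ∧ ApplyRule r (c.word n) w) ↔ ∃ d, Step n r c d ∧ w = d.word n := by
  have e1 : ruleA1 = ⟨[([st x], zword (-1) ++ [st x] ++ zword (-(-1)))]⟩ := by decide
  have e3 : ruleA3 = ⟨[([st x1], zword 1 ++ [st x1] ++ zword (-1))]⟩ := by decide
  have e1' : ruleInv ruleA1 = ⟨[([st x], zword 1 ++ [st x] ++ zword (-1))]⟩ := by decide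
  have e3' : ruleInv ruleA3 = ⟨[([st x1], zword (-1) ++ [st x1] ++ zword (-(-1)))]⟩ := by decide
  have e2' : ruleInv ruleA2 = ⟨[([st E, st x1], [st E, st x])]⟩ := by decide
  have e4' : ruleInv ruleA4 = ⟨[([st x2, st F], [st x1, st F])]⟩ := by decide
  have a1 (q k m w) := applyRule_shift (q := q) (s := x) (by decide) (by decide) (-1) (k := k)
    (m := m) (w' := w)
  have a3 (q k m w) := applyRule_shift (q := q) (s := x1) (by decide) (by decide) 1 (k := k)
    (m := m) (w' := w)
  have a1' (q k m w) := applyRule_shift (q := q) (s := x) (by decide) (by decide) 1 (k := k)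
    (m := m) (w' := w)
  have a3' (q k m w) := applyRule_shift (q := q) (s := x1) (by decide) (by decide) (-1) (k := k)
    (m := m) (w' := w)
  have a2 (q k m w) := applyRule_left (q := q) (s := x) (t := x1) (by decide) (by decide)
    (k := k) (m := m) (w' := w)
  have a2' (q k m w) := applyRule_left (q := q) (s := x1) (t := x) (by decide) (by decide)
    (k := k) (m := m) (w' := w)
  have a4 (q k m w) := applyRule_right (q := q) (s := x1) (t := x2) (by decide) (by decide)
    (k := k) (m := m) (w' := w)
  have a4' (q k m w) := applyRule_right (q := q) (s := x2) (t := x1) (by decide) (by decide)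
    (k := k) (m := m) (w' := w)
  rw [← e1] at a1
  rw [← e3] at a3
  rw [← e1'] at a1'
  rw [← e3'] at a3'
  rw [← e2'] at a2'
  rw [← e4'] at a4'
  change ∀ q k m w, ApplyRule ruleA2 _ _ ↔ _ at a2
  change ∀ q k m w, ApplyRule ruleA4 _ _ ↔ _ at a4
  constructor
  · rintro ⟨hr, h⟩
    simp only [MA, List.mem_cons, List.not_mem_nil, or_false] at hr
    rcases hr with rfl | rfl | rfl | rfl | rfl | rfl | rfl | rfl <;> rcases c with k | k | _ <;>
      simp only [Config.word, a1, a2, a3, a4, a1', a2', a3', a4', reduceCtorEq, false_and,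
        true_and] at h
    · exact ⟨_, .inl (.a1 k), by rw [h, Config.word]; congr 1; ring⟩
    · obtain ⟨rfl, rfl⟩ := h
      exact ⟨_, .inl .a2, rfl⟩
    · exact ⟨_, .inl (.a3 k), by rw [h, Config.word]; congr 1; ring⟩
    · obtain ⟨h, rfl⟩ := h
      obtain rfl : k = n := by omega
      exact ⟨_, .inl .a4, rfl⟩
    · exact ⟨onX (k + 1), .inr ⟨_, by simpa using Edge.a1 (n := n) (k + 1), rfl⟩,
        by rw [h, Config.word]; congr 1; ring⟩
    · obtain ⟨rfl, rfl⟩ := h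
      exact ⟨_, .inr ⟨_, .a2, rfl⟩, rfl⟩
    · exact ⟨onX1 (k - 1), .inr ⟨_, by simpa using Edge.a3 (n := n) (k - 1), rfl⟩,
        by rw [h, Config.word]; congr 1; ring⟩
    · exact ⟨_, .inr ⟨_, .a4, rfl⟩, by simp [h, Config.word]⟩
  · rintro ⟨d, h | ⟨s, h, rfl⟩, rfl⟩ <;> cases h
    · rename_i k
      refine ⟨by simp [MA], ?_⟩
      simp only [Config.word, a1, true_and]
      congr 1; ring
    · exact ⟨by simp [MA], (a2 _ _ _ _).2 ⟨rfl, rfl, rfl⟩⟩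
    · refine ⟨by simp [MA], ?_⟩
      simp only [Config.word, a3, true_and]
      congr 1; ring
    · exact ⟨by simp [MA], (a4 _ _ _ _).2 ⟨rfl, by ring, rfl⟩⟩
    · refine ⟨by simp [MA], ?_⟩
      simp only [Config.word, a1', true_and]
      congr 1 <;> ring
    · exact ⟨by simp [MA], (a2' _ _ _ _).2 ⟨rfl, rfl, rfl⟩⟩
    · refine ⟨by simp [MA], ?_⟩
      simp only [Config.word, a3', true_and]
      congr 1 <;> ring
    · exact ⟨by simp [MA], (a4' _ _ _ _).2 ⟨rfl, rfl, by simp [Config.word]⟩⟩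

lemma negCount_tapeWord (q : St) (k m : ℤ) (a : Unit) :
    negCount a (tapeWord q k m) = (-k).toNat + (-m).toNat := by
  have h (k : ℤ) : negCount a (zword k) = (-k).toNat := by
    rw [negCount, zword, List.countP_replicate]
    by_cases hk : 0 ≤ k
    · simp [al, hk]
      omega
    · simp [al, hk]
      omega
  have append (u v : GWord Unit St) : negCount a (u ++ v) = negCount a u + negCount a v :=
    List.countP_append
  have cons (s : St) (v : GWord Unit St) : negCount a (st s :: v) = negCount a v :=
    List.countP_cons_of_neg (by simp [st])
  rw [tapeWord, cons, append, cons, append, h, h]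
  rfl

lemma negCount_word (n : ℕ) (c : Config) (a : Unit) : negCount a (c.word n) = c.neg n := by
  cases c <;> simp [Config.word, Config.neg, negCount_tapeWord]

lemma length_word (n : ℕ) (c : Config) : (c.word n).length = n + 3 + 2 * c.neg n := by
  cases c <;> simp [Config.word, Config.neg, tapeWord, zword] <;> omega

lemma admissible_word (n : ℕ) (c : Config) : MA.H.Admissible (c.word n) := by
  have key (q : St) (hq : q ∈ ({x, x1, x2} : Set St)) (k m : ℤ) :
      HA.Admissible (tapeWord q k m) := by
    refine ⟨![E, q, F], ![List.replicate k.natAbs ((), decide (0 ≤ k)),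
      List.replicate m.natAbs ((), decide (0 ≤ m))], ?_, ?_, ?_⟩
    · intro i
      change Fin 3 at i
      fin_cases i <;> simp [HA]
      simpa using hq
    · intro i
      change Fin 2 at i
      refine ⟨fun _ _ => trivial, ?_⟩
      fin_cases i <;> exact freeReduced_replicate _ _
    · simp [SHardware.assemble, HA, List.finRange_succ, tapeWord, zword, liftT, st, al]
  cases c <;> exact key _ (by simp) _ _

lemma Config.Edge.left_unique {n : ℕ} {r : SRule Unit St} {c c' d e : Config}
    (h : Edge n r d c) (h' : Edge n r e c') (hc : c = c') : d = e := by
  cases h <;> cases h' <;> simp_all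

lemma Config.Step.functional {n : ℕ} {r : SRule Unit St} {c d e : Config} (h : Step n r c d)
    (h' : Step n r c e) : d = e := by
  have disjoint {s s' : SRule Unit St} {a a' b b' : Config} (hs : Edge n s a b)
      (hs' : Edge n s' a' b') : s ≠ ruleInv s' := by
    cases hs <;> cases hs' <;> decide
  rcases h with h | ⟨s, h, hs⟩ <;> rcases h' with h' | ⟨s', h', hs'⟩
  · cases h <;> cases h' <;> rfl
  · exact absurd hs' (disjoint h h')
  · exact absurd hs (disjoint h' h)
  · obtain rfl : s = s' := by
      rw [← h.ruleInv_ruleInv, ← h'.ruleInv_ruleInv, ← hs, ← hs']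
    exact h.left_unique h' rfl

/-- `p c` is the history of a reduced path to the configuration `c`; every edge of the
configuration graph extends such a path by one rule, in one of its two directions, and
negative letters are not lost along the path. -/
def IsPathTree (n : ℕ) (p : Config → List (SRule Unit St)) : Prop :=
  ∀ r c d, Edge n r c d → (p d = p c ++ [r] ∧ c.neg n ≤ d.neg n) ∨
    (p c = p d ++ [ruleInv r] ∧ d.neg n ≤ c.neg n)

/-- The word `r^k` of rules for an integer `k`. -/
def rpow (r : SRule Unit St) (k : ℤ) : List (SRule Unit St) :=
  if 0 ≤ k then List.replicate k.toNat r else List.replicate (-k).toNat (ruleInv r)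

lemma rpow_zero (r : SRule Unit St) : rpow r 0 = [] := by simp [rpow]

lemma length_rpow (r : SRule Unit St) (k : ℤ) : (rpow r k).length = k.natAbs := by
  unfold rpow
  split_ifs <;> simp <;> omega

lemma rpow_add_one {r : SRule Unit St} {k : ℤ} (h : 0 ≤ k) :
    rpow r (k + 1) = rpow r k ++ [r] := by
  rw [rpow, rpow, if_pos h, if_pos (by omega), Int.toNat_add h (by omega)]
  exact List.replicate_succ'

lemma rpow_sub_one {r : SRule Unit St} {k : ℤ} (h : k ≤ 0) :
    rpow r (k - 1) = rpow r k ++ [ruleInv r] := by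
  rw [rpow, if_neg (by omega), show (-(k - 1)).toNat = (-k).toNat + 1 by omega,
    List.replicate_succ', rpow]
  split_ifs with h'
  · obtain rfl : k = 0 := by omega
    rfl
  · rfl

/-- The reduced path from `W` to a configuration. -/
def pathW (n : ℕ) : Config → List (SRule Unit St)
  | onX k => rpow ruleA1 (n - k)
  | onX1 k => rpow ruleA1 n ++ [ruleA2] ++ rpow ruleA3 k
  | onX2 => rpow ruleA1 n ++ [ruleA2] ++ rpow ruleA3 n ++ [ruleA4]

/-- The reduced path from `W₂` to a configuration. -/
def pathW2 (n : ℕ) : Config → List (SRule Unit St)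
  | onX2 => []
  | onX1 k => [ruleInv ruleA4] ++ rpow ruleA3 (k - n)
  | onX k => [ruleInv ruleA4] ++ rpow ruleA3 (-n) ++ [ruleInv ruleA2] ++ rpow ruleA1 (-k)

lemma isPathTree_pathW (n : ℕ) : IsPathTree n (pathW n) := by
  rintro r c d (k | _ | k | _)
  · rcases le_total k n with h | h
    · left
      refine ⟨?_, by simp only [neg]; omega⟩
      simp only [pathW]
      rw [show (n : ℤ) - (k - 1) = n - k + 1 by ring, rpow_add_one (by omega)]
    · by_cases hk : k = n
      · subst hk
        left
        refine ⟨?_, by simp only [neg]; omega⟩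
        simp only [pathW]
        rw [show (n : ℤ) - (n - 1) = n - n + 1 by ring, rpow_add_one (by omega)]
      · right
        refine ⟨?_, by simp only [neg]; omega⟩
        simp only [pathW]
        rw [← rpow_sub_one (by omega)]
        congr 1; ring
  · left
    simp [pathW, rpow_zero, neg]
  · rcases le_or_gt 0 k with h | h
    · left
      refine ⟨?_, by simp only [neg]; omega⟩
      simp only [pathW]
      rw [rpow_add_one h, List.append_assoc _ (rpow ruleA3 k)]
    · right
      refine ⟨?_, by simp only [neg]; omega⟩
      simp only [pathW]
      rw [List.append_assoc _ _ [ruleInv ruleA3], ← rpow_sub_one (by omega)]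
      congr 2; ring
  · left
    simp [pathW, neg]

lemma isPathTree_pathW2 (n : ℕ) : IsPathTree n (pathW2 n) := by
  rintro r c d (k | _ | k | _)
  · rcases le_or_gt k 0 with h | h
    · left
      refine ⟨?_, by simp only [neg]; omega⟩
      simp only [pathW2]
      rw [List.append_assoc _ _ [ruleA1], ← rpow_add_one (by omega)]
      congr 2; ring
    · right
      refine ⟨?_, by simp only [neg]; omega⟩
      simp only [pathW2]
      rw [List.append_assoc _ _ [ruleInv ruleA1], ← rpow_sub_one (by omega)]
      congr 2; ring
  · right
    simp [pathW2, rpow_zero, neg]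
  · rcases le_or_gt (n : ℤ) k with h | h
    · left
      refine ⟨?_, by simp only [neg]; omega⟩
      simp only [pathW2]
      rw [List.append_assoc _ _ [ruleA3], ← rpow_add_one (by omega)]
      congr 2; ring
    · right
      refine ⟨?_, by simp only [neg]; omega⟩
      simp only [pathW2]
      rw [List.append_assoc _ _ [ruleInv ruleA3], ← rpow_sub_one (by omega)]
      congr 2; ring
  · right
    simp [pathW2, rpow_zero, neg]

lemma IsPathTree.step {n : ℕ} {p : Config → List (SRule Unit St)} (hp : IsPathTree n p)
    {r : SRule Unit St} {c d : Config} (h : Step n r c d) :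
    (p d = p c ++ [r] ∧ c.neg n ≤ d.neg n) ∨ ∃ l s, p c = l ++ [s] ∧ r = ruleInv s := by
  rcases h with h | ⟨s, h, rfl⟩
  · rcases hp _ _ _ h with h' | ⟨h', -⟩
    · exact .inl h'
    · exact .inr ⟨_, _, h', h.ruleInv_ruleInv.symm⟩
  · rcases hp _ _ _ h with ⟨h', -⟩ | h'
    · exact .inr ⟨_, _, h', rfl⟩
    · exact .inl h'

/-- A reduced computation follows the unique reduced paths in the configuration graph. -/
lemma exists_trace {n : ℕ} {p : Config → List (SRule Unit St)} (hp : IsPathTree n p)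
    {c₀ : Config} (h₀ : p c₀ = []) {ws : List (GWord Unit St)} {h : List (SRule Unit St)}
    (hc : IsComputation MA ws h) (hr : ReducedHist h) (hf : firstW ws = c₀.word n) :
    ∃ C : ℕ → Config, C 0 = c₀ ∧
      (∀ i ≤ h.length, ws.getD i [] = (C i).word n ∧ h.take i = p (C i)) ∧
      (∀ i < h.length, Step n (h.getD i ⟨[]⟩) (C i) (C (i + 1)) ∧
        (C i).neg n ≤ (C (i + 1)).neg n) := by
  obtain ⟨hne, hlen, -, hstep⟩ := hc
  have next (i : ℕ) (c : Config) : ∃ d, i < h.length → ws.getD i [] = c.word n →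
      Step n (h.getD i ⟨[]⟩) c d ∧ ws.getD (i + 1) [] = d.word n := by
    by_cases hi : i < h.length ∧ ws.getD i [] = c.word n
    · have := hstep i hi.1
      rw [hi.2] at this
      obtain ⟨d, hd⟩ := apply_word_iff.1 this
      exact ⟨d, fun _ _ => hd⟩
    · exact ⟨c, fun h1 h2 => absurd ⟨h1, h2⟩ hi⟩
  choose f hf' using next
  let C : ℕ → Config := fun i => Nat.rec c₀ (fun i c => f i c) i
  have hCs (i : ℕ) : C (i + 1) = f i (C i) := rfl
  have extend (i : ℕ) (hi : i < h.length) (hw : ws.getD i [] = (C i).word n)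
      (ht : h.take i = p (C i)) : Step n (h.getD i ⟨[]⟩) (C i) (C (i + 1)) ∧
        ws.getD (i + 1) [] = (C (i + 1)).word n ∧
        p (C (i + 1)) = p (C i) ++ [h.getD i ⟨[]⟩] ∧ (C i).neg n ≤ (C (i + 1)).neg n := by
    obtain ⟨h1, h2⟩ := hf' i (C i) hi hw
    refine ⟨h1, h2, ?_⟩
    rcases hp.step h1 with h3 | ⟨l, s, h3, h4⟩
    · exact h3
    · exfalso
      rw [← ht] at h3
      rcases i with _ | j
      · simp at h3
      · refine hr j hi ?_
        have : h.getD j ⟨[]⟩ = s := by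
          rw [List.take_succ_eq_append_getElem (by omega)] at h3
          have h5 := (List.append_inj' h3 rfl).2
          rw [List.getD_eq_getElem _ _ (by omega)]
          simpa using h5
        rw [this, h4]
  have main (i : ℕ) (hi : i ≤ h.length) :
      ws.getD i [] = (C i).word n ∧ h.take i = p (C i) := by
    induction i with
    | zero =>
      refine ⟨?_, h₀.symm⟩
      cases ws with
      | nil => exact absurd rfl hne
      | cons w ws => exact hf
    | succ i ih =>
      obtain ⟨h1, h2⟩ := ih (by omega)
      obtain ⟨-, h3, h4, -⟩ := extend i hi h1 h2
      refine ⟨h3, ?_⟩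
      rw [h4, ← h2, List.take_succ_eq_append_getElem hi, List.getD_eq_getElem _ _ hi]
  exact ⟨C, rfl, main, fun i hi =>
    have := extend i hi (main i hi.le).1 (main i hi.le).2
    ⟨this.1, this.2.2.2⟩⟩

lemma lastW_eq_getD {ws : List (GWord Unit St)} {h : List (SRule Unit St)}
    (hc : IsComputation MA ws h) : lastW ws = ws.getD h.length [] := by
  have := hc.2.1
  rw [lastW, List.getLastD_eq_getLast?, List.getLast?_eq_getElem?, ← this, List.getD]
  rfl

/-- If every path of the tree is at most `2n + 2` steps longer than the number of negative letters
at its end, then reduced computations are semiproper, of linear length and quadratic area. -/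
lemma bounds_of_isPathTree {n : ℕ} {p : Config → List (SRule Unit St)} (hp : IsPathTree n p)
    {c₀ : Config} (h₀ : p c₀ = []) (hlen : ∀ c, (p c).length ≤ 2 * n + 2 + c.neg n)
    {ws : List (GWord Unit St)} {h : List (SRule Unit St)}
    (hc : IsComputation MA ws h) (hr : ReducedHist h) (hf : firstW ws = c₀.word n) :
    Semiproper ws ∧ ws.length ≤ (firstW ws).length + (lastW ws).length ∧
      SArea ws ≤ ((firstW ws).length + (lastW ws).length) ^ 2 := by
  obtain ⟨C, -, hC, hstep⟩ := exists_trace hp h₀ hc hr hf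
  have hmono (i j : ℕ) (hij : i ≤ j) (hj : j ≤ h.length) : (C i).neg n ≤ (C j).neg n := by
    induction j, hij using Nat.le_induction with
    | base => exact le_rfl
    | succ j _ ih => exact (ih (by omega)).trans (hstep j hj).2
  have hws := hc.2.1
  have hlast : lastW ws = (C h.length).word n := by rw [lastW_eq_getD hc, (hC _ le_rfl).1]
  have hL : ws.length ≤ (firstW ws).length + (lastW ws).length := by
    have h1 : h.length = (p (C h.length)).length := by
      rw [← (hC _ le_rfl).2, List.take_length]
    have h2 := hlen (C h.length)
    rw [hf, hlast, length_word, length_word]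
    omega
  refine ⟨?_, hL, ?_⟩
  · intro a i j hij hj
    rw [(hC i (by omega)).1, (hC j (by omega)).1, negCount_word, negCount_word]
    exact (Nat.sub_le _ _).trans (hmono i j hij (by omega))
  · have hsum : SArea ws ≤ ws.length * (lastW ws).length := by
      have := List.sum_le_card_nsmul (ws.map List.length) (lastW ws).length (by
        intro m hm
        obtain ⟨w, hw, rfl⟩ := List.mem_map.1 hm
        obtain ⟨i, hi, rfl⟩ := List.mem_iff_getElem.1 hw
        have hw' := (hC i (by omega)).1
        rw [List.getD_eq_getElem _ _ hi] at hw'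
        have := hmono i h.length (by omega) le_rfl
        rw [hlast, hw', length_word, length_word]
        omega)
      simpa [SArea] using this
    refine hsum.trans ?_
    rw [sq]
    exact Nat.mul_le_mul hL (by omega)

lemma length_pathW (n : ℕ) (c : Config) : (pathW n c).length ≤ 2 * n + 2 + c.neg n := by
  cases c <;> simp only [pathW, neg, List.length_append, length_rpow, List.length_cons,
    List.length_nil] <;> omega

lemma length_pathW2 (n : ℕ) (c : Config) : (pathW2 n c).length ≤ 2 * n + 2 + c.neg n := by
  cases c <;> simp only [pathW2, neg, List.length_append, length_rpow, List.length_cons,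
    List.length_nil] <;> omega

lemma Wst_eq_word (n : ℕ) : Wst n = (onX n).word n := by
  simp [Wst, Config.word, tapeWord, apow, zword]

lemma W2_eq_word (n : ℕ) : W2 n = onX2.word n := by
  simp [W2, Config.word, tapeWord, apow, zword]

lemma pathW_onX_self (n : ℕ) : pathW n (onX n) = [] := by simp [pathW, rpow_zero]

/-- A configuration whose word contains `x₂` is the one with middle letter `x₂`. -/
lemma eq_onX2_of_infix {n : ℕ} {c : Config} (h : [st x2] <:+: c.word n) : c = onX2 := by
  obtain ⟨a, b, h⟩ := h
  have h' : c.word n = a ++ st x2 :: b := by simpa using h.symm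
  cases c with
  | onX2 => rfl
  | _ => exact absurd (tapeWord_split (by decide) (by decide) h').1 (by decide)

/-- A configuration whose word contains `xF` is that of `W`. -/
lemma eq_onX_of_infix {n : ℕ} {c : Config} (h : [st x, st F] <:+: c.word n) : c = onX n := by
  obtain ⟨a, b, h⟩ := h
  have h' : c.word n = a ++ st x :: (st F :: b) := by simpa using h.symm
  cases c with
  | onX k =>
    have h1 := (tapeWord_split (by decide) (by decide) h').2.2
    have hk : (n : ℤ) - k = 0 := by
      rw [← zword_eq_nil]
      rcases hz : zword (n - k) with _ | ⟨p, l⟩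
      · rfl
      · rw [hz, List.cons_append, List.cons.injEq] at h1
        exact absurd (by rw [hz, h1.1]; simp) (st_notMem_zword F (n - k))
    congr 1
    omega
  | _ => exact absurd (tapeWord_split (by decide) (by decide) h').1 (by decide)

/-- A reduced computation ending at a word with a subword that singles out the configuration `d`
has history `p d`. -/
lemma history_eq {n : ℕ} {p : Config → List (SRule Unit St)} (hp : IsPathTree n p)
    {c₀ d : Config} (h₀ : p c₀ = []) {v : GWord Unit St}
    (hv : ∀ c : Config, v <:+: c.word n → c = d)
    {ws : List (GWord Unit St)} {h : List (SRule Unit St)}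
    (hcs : InCS MA ws h (c₀.word n) [v]) : h = p d ∧ lastW ws = d.word n := by
  obtain ⟨hc, hr, hf, hl⟩ := hcs
  obtain ⟨C, -, hC, -⟩ := exists_trace hp h₀ hc hr hf
  obtain ⟨h1, h2⟩ := hC _ le_rfl
  rw [← lastW_eq_getD hc] at h1
  have h3 := hl v (by simp)
  rw [h1] at h3
  rw [List.take_length] at h2
  rw [← hv _ h3]
  exact ⟨h2, h1⟩

lemma eq_singleton_of_history_nil {ws : List (GWord Unit St)} {W : GWord Unit St}
    (hc : IsComputation MA ws []) (hf : firstW ws = W) : ws = [W] := by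
  obtain ⟨w, rfl⟩ := List.length_eq_one_iff.1 hc.2.1.symm
  rw [← hf]
  rfl

/-- A computation from a given word is determined by its history. -/
lemma computation_unique {n : ℕ} {p : Config → List (SRule Unit St)} (hp : IsPathTree n p)
    {c₀ : Config} (h₀ : p c₀ = []) {ws ws' : List (GWord Unit St)} {h : List (SRule Unit St)}
    (hr : ReducedHist h) (hc : IsComputation MA ws h) (hf : firstW ws = c₀.word n)
    (hc' : IsComputation MA ws' h) (hf' : firstW ws' = c₀.word n) : ws = ws' := by
  obtain ⟨C, hC0, hC, hs⟩ := exists_trace hp h₀ hc hr hf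
  obtain ⟨D, hD0, hD, ht⟩ := exists_trace hp h₀ hc' hr hf'
  have hCD (i : ℕ) (hi : i ≤ h.length) : C i = D i := by
    induction i with
    | zero => rw [hC0, hD0]
    | succ i ih =>
      have h1 := (hs i hi).1
      rw [ih (by omega)] at h1
      exact h1.functional (ht i hi).1
  have hl := hc.2.1
  have hl' := hc'.2.1
  refine List.ext_getElem (by omega) fun i hi hi' => ?_
  rw [← List.getD_eq_getElem _ [] hi, ← List.getD_eq_getElem _ [] hi', (hC i (by omega)).1,
    (hD i (by omega)).1, hCD i (by omega)]

lemma IsComputation.concat {T S : Type} {M : SMachine T S} {ws : List (GWord T S)}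
    {h : List (SRule T S)} (hc : IsComputation M ws h) {r : SRule T S} {w : GWord T S}
    (hr : r ∈ M.rules) (ha : M.H.Admissible w) (hw : ApplyRule r (lastW ws) w) :
    IsComputation M (ws ++ [w]) (h ++ [r]) := by
  obtain ⟨hne, hlen, hadm, hstep⟩ := hc
  refine ⟨by simp, by simp [hlen], ?_, ?_⟩
  · intro v hv
    rcases List.mem_append.1 hv with hv | hv
    · exact hadm v hv
    · rwa [List.mem_singleton.1 hv]
  · intro i hi
    rw [List.length_append, List.length_singleton] at hi
    rcases Nat.lt_succ_iff_lt_or_eq.1 hi with hi | rfl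
    · rw [List.getD_append _ _ _ _ hi, List.getD_append _ _ _ _ (by omega),
        List.getD_append _ _ _ _ (by omega)]
      exact hstep i hi
    · rw [List.getD_append_right _ _ _ _ le_rfl, List.getD_append _ _ _ _ (by omega),
        List.getD_append_right _ _ _ _ (by omega)]
      rw [lastW, List.getLastD_eq_getLast?, List.getLast?_eq_getElem?, ← hlen] at hw
      refine ⟨by simpa using hr, ?_⟩
      simpa [← hlen, List.getD] using hw

/-- Along `pathW`, every configuration between `W` and `W₂` is reached by a computation. -/
lemma exists_computation_onX2 (n : ℕ) :
    ∃ ws, IsComputation MA ws (pathW n onX2) ∧ firstW ws = Wst n ∧ lastW ws = onX2.word n := by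
  let Good (c : Config) : Prop :=
    ∃ ws, IsComputation MA ws (pathW n c) ∧ firstW ws = Wst n ∧ lastW ws = c.word n
  have extend {r c d} (hg : Good c) (he : Edge n r c d) (hp : pathW n d = pathW n c ++ [r]) :
      Good d := by
    obtain ⟨ws, hc, hf, hl⟩ := hg
    obtain ⟨hr, ha⟩ := apply_word_iff.2 ⟨d, .inl he, rfl⟩
    refine ⟨ws ++ [d.word n], ?_, ?_, by simp [lastW]⟩
    · rw [hp]
      exact hc.concat hr (admissible_word n d) (hl ▸ ha)
    · obtain ⟨w, l, rfl⟩ := List.exists_cons_of_ne_nil hc.1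
      exact hf
  have hX (j : ℕ) : Good (onX (n - j)) := by
    induction j with
    | zero =>
      refine ⟨[Wst n], ?_, rfl, ?_⟩
      · rw [Nat.cast_zero, sub_zero, pathW_onX_self]
        refine ⟨by simp, rfl, ?_, by simp⟩
        simp only [List.mem_singleton, forall_eq]
        rw [Wst_eq_word]
        exact admissible_word n _
      · rw [Nat.cast_zero, sub_zero, ← Wst_eq_word]
        rfl
    | succ j ih =>
      have he := Edge.a1 (n := n) (n - j)
      rw [show (n : ℤ) - j - 1 = n - (j + 1 : ℕ) by push_cast; ring] at he
      refine extend ih he ?_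
      simp only [pathW]
      rw [← rpow_add_one (by omega)]
      congr 1; push_cast; ring
  have hX1 (j : ℕ) : Good (onX1 j) := by
    induction j with
    | zero =>
      have h0 := hX n
      rw [sub_self] at h0
      exact extend h0 .a2 (by simp [pathW, rpow_zero])
    | succ j ih =>
      have he := Edge.a3 (n := n) j
      refine extend ih he ?_
      simp only [pathW]
      rw [List.append_assoc _ _ [ruleA3], ← rpow_add_one (by omega)]
      rfl
  exact extend (hX1 n) .a4 rfl

lemma pathW_onX2 (n : ℕ) : pathW n onX2 =
    List.replicate n ruleA1 ++ [ruleA2] ++ List.replicate n ruleA3 ++ [ruleA4] := by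
  simp [pathW, rpow]

lemma reducedHist_pathW_onX2 (n : ℕ) : ReducedHist (pathW n onX2) := by
  have hmem : ∀ r ∈ pathW n onX2, r ∈ [ruleA1, ruleA2, ruleA3, ruleA4] := by
    rw [pathW_onX2]
    simp only [List.mem_append, List.mem_replicate, List.mem_singleton]
    rintro r (((⟨-, rfl⟩ | rfl) | ⟨-, rfl⟩) | rfl) <;> simp
  have hne : ∀ r ∈ [ruleA1, ruleA2, ruleA3, ruleA4], ∀ s ∈ [ruleA1, ruleA2, ruleA3, ruleA4],
      s ≠ ruleInv r := by decide
  intro i hi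
  rw [List.getD_eq_getElem _ _ hi, List.getD_eq_getElem _ _ (by omega)]
  exact hne _ (hmem _ (List.getElem_mem _)) _ (hmem _ (List.getElem_mem _))

/-- Every reduced computation from `W` to `W₂` passes through the word `E x₁ αⁿ F`. -/
lemma exists_Ex1_infix {n : ℕ} {ws : List (GWord Unit St)}
    (hc : IsComputation MA ws (pathW n onX2)) (hf : firstW ws = Wst n) :
    ∃ v ∈ ws, [st E, st x1] <:+: v := by
  rw [Wst_eq_word] at hf
  obtain ⟨C, -, hC, hs⟩ := exists_trace (isPathTree_pathW n) (pathW_onX_self n) hc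
    (reducedHist_pathW_onX2 n) hf
  have hn : n < (pathW n onX2).length := by
    rw [pathW_onX2]
    simp
  have hget : (pathW n onX2).getD n ⟨[]⟩ = ruleA2 := by
    rw [pathW_onX2]
    simp [List.getD]
  have hstep := (hs n hn).1
  have hw := (hC (n + 1) hn).1
  have hlen := hc.2.1
  rw [List.getD_eq_getElem _ _ (by omega)] at hw
  refine ⟨_, List.getElem_mem (by omega : n + 1 < ws.length), ?_⟩
  rw [hw]
  rw [hget] at hstep
  generalize C (n + 1) = d at hstep
  generalize C n = c at hstep
  have hd : d = onX1 0 := by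
    rcases hstep with h | ⟨s, h, hs⟩
    · cases h
      rfl
    · cases h <;> exact absurd hs (by decide)
  rw [hd]
  exact ⟨[], zword (n - 0) ++ [st F], by simp [Config.word, tapeWord, zword_eq_nil.2 rfl]⟩

/-- the machine `S_α` moves `x` from `F` to `E` and back. -/
theorem machine_S_alpha :
    ∃ c : ℕ, 0 < c ∧ ∀ n : ℕ,
      -- (1) every reduced computation starting at `W` or `W₂` is semiproper, of length
      -- at most `O(|W| + |V|)` and area at most `O((|W| + |V|)²)`
      (∀ ws h, IsComputation MA ws h → ReducedHist h →
        (firstW ws = Wst n ∨ firstW ws = W2 n) →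
        Semiproper ws ∧
        ws.length ≤ c * ((firstW ws).length + (lastW ws).length) + c ∧
        SArea ws ≤ c * ((firstW ws).length + (lastW ws).length) ^ 2 + c) ∧
      -- (2) `CS_α(W, xF)` and `CS_α(W₂, x₂)` are single trivial computations
      (∀ ws h, InCS MA ws h (Wst n) [[st x, st F]] → ws = [Wst n] ∧ h = []) ∧
      (∀ ws h, InCS MA ws h (W2 n) [[st x2]] → ws = [W2 n] ∧ h = []) ∧
      -- (3) `CS_α(W, x₂)` consists of exactly one computation, with history
      -- `(α1)ⁿ(α2)(α3)ⁿ(α4)`, last word `W₂`, and some word containing `Ex₁`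
      (∃ ws h, InCS MA ws h (Wst n) [[st x2]]) ∧
      (∀ ws h, InCS MA ws h (Wst n) [[st x2]] →
        h = List.replicate n ruleA1 ++ [ruleA2] ++ List.replicate n ruleA3 ++ [ruleA4] ∧
        lastW ws = W2 n ∧ ∃ v ∈ ws, [st E, st x1] <:+: v) ∧
      (∀ ws h ws' h', InCS MA ws h (Wst n) [[st x2]] →
        InCS MA ws' h' (Wst n) [[st x2]] → ws = ws' ∧ h = h') := by
  refine ⟨1, one_pos, fun n => ⟨?_, ?_, ?_, ?_, ?_, ?_⟩⟩
  · intro ws h hc hr hf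
    rw [Wst_eq_word, W2_eq_word] at hf
    have key : Semiproper ws ∧ ws.length ≤ (firstW ws).length + (lastW ws).length ∧
        SArea ws ≤ ((firstW ws).length + (lastW ws).length) ^ 2 := by
      rcases hf with hf | hf
      · exact bounds_of_isPathTree (isPathTree_pathW n) (pathW_onX_self n) (length_pathW n)
          hc hr hf
      · exact bounds_of_isPathTree (isPathTree_pathW2 n) rfl (length_pathW2 n) hc hr hf
    exact ⟨key.1, by omega, by omega⟩
  · intro ws h hcs
    rw [Wst_eq_word] at hcs ⊢
    obtain ⟨rfl, -⟩ := history_eq (isPathTree_pathW n) (pathW_onX_self n)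
      (fun _ => eq_onX_of_infix) hcs
    rw [pathW_onX_self] at hcs ⊢
    exact ⟨eq_singleton_of_history_nil hcs.1 hcs.2.2.1, rfl⟩
  · intro ws h hcs
    rw [W2_eq_word] at hcs ⊢
    obtain ⟨rfl, -⟩ := history_eq (isPathTree_pathW2 n) rfl (fun _ => eq_onX2_of_infix) hcs
    exact ⟨eq_singleton_of_history_nil hcs.1 hcs.2.2.1, rfl⟩
  · obtain ⟨ws, hc, hf, hl⟩ := exists_computation_onX2 n
    refine ⟨ws, _, hc, reducedHist_pathW_onX2 n, hf, ?_⟩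
    simp only [List.mem_singleton, forall_eq]
    rw [hl]
    exact ⟨st E :: zword n, zword 0 ++ [st F], by simp [Config.word, tapeWord]⟩
  · intro ws h hcs
    obtain ⟨rfl, hl⟩ := history_eq (isPathTree_pathW n) (pathW_onX_self n)
      (fun _ => eq_onX2_of_infix) (Wst_eq_word n ▸ hcs)
    exact ⟨pathW_onX2 n, by rw [hl, W2_eq_word], exists_Ex1_infix hcs.1 hcs.2.2.1⟩
  · intro ws h ws' h' hcs hcs'
    rw [Wst_eq_word] at hcs hcs'
    obtain ⟨rfl, -⟩ := history_eq (isPathTree_pathW n) (pathW_onX_self n)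
      (fun _ => eq_onX2_of_infix) hcs
    obtain ⟨rfl, -⟩ := history_eq (isPathTree_pathW n) (pathW_onX_self n)
      (fun _ => eq_onX2_of_infix) hcs'
    exact ⟨computation_unique (isPathTree_pathW n) (pathW_onX_self n) hcs.2.1 hcs.1 hcs.2.2.1
      hcs'.1 hcs'.2.2.1, rfl⟩
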